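/- arXiv:1511.03253 — 4 statements merged into one kernel-verified Lean document; each statement's English description precedes it below -/
import Mathlib

section
/- Let g, r, n, m be integers with r ≥ 1, n ≥ 2r, m ≥ 2r, and suppose that r·(g+1) - (n+m) < r·⌊(g-1)/2⌋ (as integers). Then: (i) if g is odd, -2nm + r²(2g-2) ≤ -4r; (ii) if g is even and r is odd, -2nm + r²(2g-2) ≤ -2r(r+1); (iii) if g and r are both even, -2nm + r²(2g-2) ≤ -2(r+2). -/
/-- Display (2.3) of the paper: the purely numerical bounds on
`v(F_E)² = -2nm + r²(2g-2)` under the assumption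
`Cliff(E) = (g+1) - (n+m)/r < ⌊(g-1)/2⌋`, expressed as the integer inequality
`r(g+1) - (n+m) < r⌊(g-1)/2⌋`, with `n, m ≥ 2r`. -/
theorem mukai_square_bounds (g r n m : ℤ) (hr : 1 ≤ r) (hn : 2 * r ≤ n)
    (hm : 2 * r ≤ m)
    (h : r * (g + 1) - (n + m) < r * ⌊(((g : ℚ) - 1) / 2)⌋) :
    (Odd g → -2 * n * m + r ^ 2 * (2 * g - 2) ≤ -4 * r) ∧
    (Even g → Odd r → -2 * n * m + r ^ 2 * (2 * g - 2) ≤ -2 * r * (r + 1)) ∧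
    (Even g → Even r → -2 * n * m + r ^ 2 * (2 * g - 2) ≤ -2 * (r + 2)) := by
  have hp : 0 ≤ (n - 2 * r) * (m - 2 * r) :=
    mul_nonneg (by linarith) (by linarith)
  have even_case : Even g →
      -2 * n * m + r ^ 2 * (2 * g - 2) ≤ -4 * r - 2 * r ^ 2 := by
    rintro ⟨k, rfl⟩
    have hf : ⌊((((k + k : ℤ) : ℚ) - 1) / 2)⌋ = k - 1 := by
      rw [Int.floor_eq_iff]
      push_cast
      constructor <;> linarith
    rw [hf] at h
    have hs : r * (k + 2) + 1 ≤ n + m := by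
      have : r * (k + 2) < n + m := by linarith
      exact this
    have := mul_le_mul_of_nonneg_left hs (by linarith : 0 ≤ r)
    linarith
  refine ⟨?_, ?_, ?_⟩
  · rintro ⟨k, rfl⟩
    have hf : ⌊((((2 * k + 1 : ℤ) : ℚ) - 1) / 2)⌋ = k := by
      rw [Int.floor_eq_iff]
      push_cast
      constructor <;> linarith
    rw [hf] at h
    have hs : r * (k + 2) + 1 ≤ n + m := by
      have : r * (k + 2) < n + m := by linarith
      exact this
    have := mul_le_mul_of_nonneg_left hs (by linarith : 0 ≤ r)
    linarith
  · intro hg _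
    have := even_case hg
    linarith
  · intro hg _
    have := even_case hg
    nlinarith
end

section
/- Let g ≥ 2 be an integer and let k, ℓ, n, m be integers with k ≥ 2, ℓ ≥ 2, n - k ≥ 2, m - ℓ ≥ 2, k·ℓ ≤ g, and (n-k)·(m-ℓ) ≤ g. Then n + m ≤ 2⌈(g-1)/2⌉ + 4; equivalently, 2(g+1) - (n+m) ≥ 2⌊(g-1)/2⌋. -/
/-- Numerical core of the proof of Theorem 3 of the paper: if `k, ℓ ≥ 2`,
`n - k, m - ℓ ≥ 2`, `kℓ ≤ g` and `(n-k)(m-ℓ) ≤ g`, then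
`n + m ≤ 2⌈(g-1)/2⌉ + 4`, equivalently `2(g+1) - (n+m) ≥ 2⌊(g-1)/2⌋`. -/
theorem mercat_rank_two_numerics (g k l n m : ℤ) (hg : 2 ≤ g)
    (hk : 2 ≤ k) (hl : 2 ≤ l) (hnk : 2 ≤ n - k) (hml : 2 ≤ m - l)
    (h1 : k * l ≤ g) (h2 : (n - k) * (m - l) ≤ g) :
    n + m ≤ 2 * ⌈(((g : ℚ) - 1) / 2)⌉ + 4 ∧
    2 * (g + 1) - (n + m) ≥ 2 * ⌊(((g : ℚ) - 1) / 2)⌋ := by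
  have a1 : 2 * (k + l) ≤ g + 4 := by
    nlinarith [mul_nonneg (sub_nonneg.2 hk) (sub_nonneg.2 hl)]
  have a2 : 2 * ((n - k) + (m - l)) ≤ g + 4 := by
    nlinarith [mul_nonneg (sub_nonneg.2 hnk) (sub_nonneg.2 hml)]
  have c1 : g - 1 ≤ 2 * ⌈(((g : ℚ) - 1) / 2)⌉ := by
    have h := Int.le_ceil (((g : ℚ) - 1) / 2)
    have h' : (g : ℚ) - 1 ≤ 2 * (⌈(((g : ℚ) - 1) / 2)⌉ : ℚ) := by linarith
    exact_mod_cast h'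
  have c2 : 2 * ⌊(((g : ℚ) - 1) / 2)⌋ ≤ g - 1 := by
    have h := Int.floor_le (((g : ℚ) - 1) / 2)
    have h' : 2 * (⌊(((g : ℚ) - 1) / 2)⌋ : ℚ) ≤ (g : ℚ) - 1 := by linarith
    exact_mod_cast h'
  constructor <;> omega
end

section
/- Let g ≥ 4 be an integer with g ≠ 9, and let k, ℓ, n, m be integers with m ≥ n ≥ 5, 2k ≥ n, n - k ≥ 2, ℓ ≥ 2, m - ℓ ≥ 2, k·ℓ ≤ g, (n-k)·(m-ℓ) ≤ g, and n + m = 2(g+1) - 2⌊(g-1)/2⌋. Then k = ⌈(g-1)/2⌉, ℓ = 2, n = ⌈(g-1)/2⌉ + 2, and m = ⌈(g-1)/2⌉ + 2. -/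
/-- Two integers at least `2` whose product is at most `2p + 1`
have sum at most `p + 2`; if equality holds, then one of them is `2` or `p = 4`. -/
lemma pair_bound (p a b : ℤ) (ha : 2 ≤ a) (hb : 2 ≤ b) (h : a * b ≤ 2 * p + 1) :
    a + b ≤ p + 2 ∧ (a + b = p + 2 → a = 2 ∨ b = 2 ∨ (p = 4 ∧ a * b = 9)) := by
  have h0 : 0 ≤ (a - 2) * (b - 2) := mul_nonneg (by omega) (by omega)
  have h0' : 0 ≤ a * b - 2 * (a + b) + 4 := by linarith
  refine ⟨by omega, fun he => ?_⟩
  by_contra! hc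
  obtain ⟨h1, h2, h3⟩ := hc
  have ha3 : 3 ≤ a := by omega
  have hb3 : 3 ≤ b := by omega
  have ha4 : a ≤ 3 := by nlinarith
  have hb4 : b ≤ 3 := by nlinarith
  have ea : a = 3 := by omega
  have eb : b = 3 := by omega
  subst ea eb
  exact h3 (by omega) (by norm_num)

/-- Numerical core of Proposition 2.8 of the paper: with `g ≥ 4`, `g ≠ 9`,
`m ≥ n ≥ 5`, `2k ≥ n`, `n - k ≥ 2`, `ℓ ≥ 2`, `m - ℓ ≥ 2`, `kℓ ≤ g`,
`(n-k)(m-ℓ) ≤ g` and `n + m = 2(g+1) - 2⌊(g-1)/2⌋`, one gets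
`k = ⌈(g-1)/2⌉`, `ℓ = 2`, `n = m = ⌈(g-1)/2⌉ + 2`. -/
theorem equal_clifford_numerics (g k l n m : ℤ) (hg : 4 ≤ g) (hg9 : g ≠ 9)
    (hn : 5 ≤ n) (hnm : n ≤ m) (hkn : n ≤ 2 * k) (hnk : 2 ≤ n - k)
    (hl : 2 ≤ l) (hml : 2 ≤ m - l) (h1 : k * l ≤ g) (h2 : (n - k) * (m - l) ≤ g)
    (hsum : n + m = 2 * (g + 1) - 2 * ⌊(((g : ℚ) - 1) / 2)⌋) :
    k = ⌈(((g : ℚ) - 1) / 2)⌉ ∧ l = 2 ∧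
      n = ⌈(((g : ℚ) - 1) / 2)⌉ + 2 ∧ m = ⌈(((g : ℚ) - 1) / 2)⌉ + 2 := by
  obtain ⟨p, hp | hp⟩ := Int.even_or_odd' g
  · have hf : ⌊(((g : ℚ) - 1) / 2)⌋ = p - 1 := by
      rw [Int.floor_eq_iff, hp]; push_cast; constructor <;> linarith
    have hc : ⌈(((g : ℚ) - 1) / 2)⌉ = p := by
      rw [Int.ceil_eq_iff, hp]; push_cast; constructor <;> linarith
    rw [hf] at hsum
    rw [hc]
    obtain ⟨q1, r1⟩ := pair_bound p k l (by omega) hl (by omega)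
    obtain ⟨q2, r2⟩ := pair_bound p (n - k) (m - l) hnk hml (by omega)
    have e1 := r1 (by omega)
    have e2 := r2 (by omega)
    omega
  · have hf : ⌊(((g : ℚ) - 1) / 2)⌋ = p := by
      rw [Int.floor_eq_iff, hp]; push_cast; constructor <;> linarith
    have hc : ⌈(((g : ℚ) - 1) / 2)⌉ = p := by
      rw [Int.ceil_eq_iff, hp]; push_cast; constructor <;> linarith
    rw [hf] at hsum
    rw [hc]
    obtain ⟨q1, r1⟩ := pair_bound p k l (by omega) hl (by omega)
    obtain ⟨q2, r2⟩ := pair_bound p (n - k) (m - l) hnk hml (by omega)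
    have e1 := r1 (by omega)
    have e2 := r2 (by omega)
    omega
end

section
/- Let g ≥ 2 be an integer and let n, m be integers with m ≥ n ≥ 5 and n + m = 2(g+1) - 2⌊(g-1)/2⌋. Then: (i) if -2nm + 8(g-1) ≥ -2, then g = 7; (ii) if -2nm + 8(g-1) ≥ -8, then g = 7 or g = 9. -/
/-- Numerical content of Proposition 2.5 of the paper: with `m ≥ n ≥ 5` and
`n + m = 2(g+1) - 2⌊(g-1)/2⌋`, (i) `-2nm + 8(g-1) ≥ -2` forces `g = 7`, and
(ii) `-2nm + 8(g-1) ≥ -8` forces `g = 7` or `g = 9`. -/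
theorem not_stable_numerics (g n m : ℤ) (hg : 2 ≤ g) (hn : 5 ≤ n)
    (hnm : n ≤ m)
    (hsum : n + m = 2 * (g + 1) - 2 * ⌊(((g : ℚ) - 1) / 2)⌋) :
    (-2 * n * m + 8 * (g - 1) ≥ -2 → g = 7) ∧
    (-2 * n * m + 8 * (g - 1) ≥ -8 → g = 7 ∨ g = 9) := by
  have hk : ⌊(((g : ℚ) - 1) / 2)⌋ = (g - 1) / 2 := by
    have h := Rat.floor_intCast_div_natCast (g - 1) 2
    push_cast at h
    exact h
  rw [hk] at hsum
  have hp : 0 ≤ (n - 5) * (m - 5) := mul_nonneg (by linarith) (by linarith)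
  have hq : (n - 5) * (m - 5) = n * m - 5 * n - 5 * m + 25 := by ring
  have hr : -2 * n * m = -2 * (n * m) := by ring
  rw [hr]
  rw [hq] at hp
  generalize n * m = p at *
  constructor
  · intro h
    omega
  · intro h
    omega
end
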